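/- Suppose u* > Ψ(α). Then the pair (ψ, 0) is the unique weak solution of the HHMO model: any weak solution (u, p) satisfies u(x,t) = ψ(x,t) for all (x,t) ∈ ℝ × [0,∞) and p(x,t) = 0 for all (x,t) ∈ ℝ × [0,∞). -/

import Mathlib

open MeasureTheory Filter Set

noncomputable section

/-- The precipitation-free self-similar solution `ψ(x,t)`. -/
def psi (α β x t : ℝ) : ℝ :=
  if 0 < t then
    (α * β / 2) * Real.exp (α ^ 2 / 4) *
      ∫ ζ in Set.Ioi (max (|x| / Real.sqrt t) α), Real.exp (-ζ ^ 2 / 4)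
  else 0

/-- The profile `Ψ(η)` in similarity coordinates. -/
def PsiP (α β η : ℝ) : ℝ :=
  (α * β / 2) * Real.exp (α ^ 2 / 4) * ∫ ζ in Set.Ioi (max η α), Real.exp (-ζ ^ 2 / 4)

/-- Regularity of a weak solution: `w` is the spatial derivative of `u - ψ`;
both are continuous on `ℝ × [0,∞)` and bounded on `ℝ × [0,T]` for every `T > 0`. -/
def AuxReg (α β : ℝ) (u w : ℝ → ℝ → ℝ) : Prop :=
  (∀ t ∈ Set.Ici (0:ℝ), ∀ x : ℝ, HasDerivAt (fun y => u y t - psi α β y t) (w x t) x) ∧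
  ContinuousOn (fun q : ℝ × ℝ => u q.1 q.2 - psi α β q.1 q.2) (Set.univ ×ˢ Set.Ici 0) ∧
  ContinuousOn (fun q : ℝ × ℝ => w q.1 q.2) (Set.univ ×ˢ Set.Ici 0) ∧
  ∀ T > (0:ℝ), ∃ C : ℝ, ∀ x : ℝ, ∀ t ∈ Set.Icc (0:ℝ) T,
    |u x t - psi α β x t| ≤ C ∧ |w x t| ≤ C

/-- A test function of class `C^{1,1}(ℝ × [0,T])`, vanishing for large `|x|` and at `t = T`,
together with its partial derivatives `φt`, `φx`. -/
def IsTestFun (T : ℝ) (φ φt φx : ℝ → ℝ → ℝ) : Prop :=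
  (∀ x : ℝ, ∀ t ∈ Set.Icc (0:ℝ) T,
    HasDerivWithinAt (fun s => φ x s) (φt x t) (Set.Icc 0 T) t) ∧
  (∀ x : ℝ, ∀ t ∈ Set.Icc (0:ℝ) T, HasDerivAt (fun y => φ y t) (φx x t) x) ∧
  ContinuousOn (fun q : ℝ × ℝ => φ q.1 q.2) (Set.univ ×ˢ Set.Icc 0 T) ∧
  ContinuousOn (fun q : ℝ × ℝ => φt q.1 q.2) (Set.univ ×ˢ Set.Icc 0 T) ∧
  ContinuousOn (fun q : ℝ × ℝ => φx q.1 q.2) (Set.univ ×ˢ Set.Icc 0 T) ∧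
  (∃ R : ℝ, ∀ x : ℝ, ∀ t ∈ Set.Icc (0:ℝ) T, R ≤ |x| → φ x t = 0) ∧
  (∀ x : ℝ, φ x T = 0)

/-- The weak form of the equation, relative to a given precipitation function `p` and
the spatial derivative `w` of `u - ψ`. -/
def WeakForm (α β : ℝ) (u p w : ℝ → ℝ → ℝ) : Prop :=
  ∀ T > (0:ℝ), ∀ φ φt φx : ℝ → ℝ → ℝ, IsTestFun T φ φt φx →
    (∫ t in Set.Ioc (0:ℝ) T, ∫ x : ℝ, φt x t * (u x t - psi α β x t))
      = ∫ t in Set.Ioc (0:ℝ) T, ∫ x : ℝ, (φx x t * w x t + p x t * u x t * φ x t)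

/-- A weak solution of the linear auxiliary problem with given precipitation function `p`. -/
def IsAuxSolution (α β : ℝ) (p u : ℝ → ℝ → ℝ) : Prop :=
  (∀ x t : ℝ, u (-x) t = u x t) ∧
  ∃ w : ℝ → ℝ → ℝ, AuxReg α β u w ∧ WeakForm α β u p w

/-- A weak solution `(u, p)` of the HHMO model. -/
def IsWeakSolution (α β ustar : ℝ) (u p : ℝ → ℝ → ℝ) : Prop :=
  (∀ x t : ℝ, u (-x) t = u x t) ∧
  (∀ x t : ℝ, p (-x) t = p x t) ∧
  Measurable (fun q : ℝ × ℝ => p q.1 q.2) ∧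
  (∀ x : ℝ, ∀ t ∈ Set.Ici (0:ℝ),
    (sSup ((fun s => u x s) '' Set.Icc 0 t) < ustar → p x t = 0) ∧
    (sSup ((fun s => u x s) '' Set.Icc 0 t) = ustar → p x t ∈ Set.Icc (0:ℝ) 1) ∧
    (ustar < sSup ((fun s => u x s) '' Set.Icc 0 t) → p x t = 1)) ∧
  (∀ x : ℝ, MonotoneOn (fun t => p x t) (Set.Ici (0:ℝ))) ∧
  ∃ w : ℝ → ℝ → ℝ, AuxReg α β u w ∧ WeakForm α β u p w

/-- Condition (P): the precipitation function depends only on `x` beyond the parabola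
`t = x²/α²`. -/
def CondP (α : ℝ) (p : ℝ → ℝ → ℝ) (pstar : ℝ → ℝ) : Prop :=
  Measurable pstar ∧
  ∀ᵐ x ∂(volume.restrict (Set.Ioi (0:ℝ))), ∀ t : ℝ, x ^ 2 / α ^ 2 < t → p x t = pstar x

/-- The admissible class `𝒜` of precipitation functions. -/
def IsAdmissible (p : ℝ → ℝ → ℝ) : Prop :=
  (∀ x t : ℝ, p (-x) t = p x t) ∧
  MeasureTheory.LocallyIntegrableOn (fun q : ℝ × ℝ => p q.1 q.2) (Set.Ioi 0 ×ˢ Set.Ici 0) ∧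
  ∀ T > (0:ℝ), ∃ R : ℝ, ∀ x ≥ R, ∀ t ∈ Set.Icc (0:ℝ) T, p x t = 0

/-- `u` converges uniformly, in parabolic similarity coordinates, to the profile `Φ`. -/
def ConvUnif (u : ℝ → ℝ → ℝ) (Φ : ℝ → ℝ) : Prop :=
  ∀ ε > (0:ℝ), ∃ T : ℝ, ∀ t ≥ T, ∀ η ≥ (0:ℝ), |u (η * Real.sqrt t) t - Φ η| < ε

/-- The error function. -/
def erf (x : ℝ) : ℝ := (2 / Real.sqrt Real.pi) * ∫ s in (0:ℝ)..x, Real.exp (-s ^ 2)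

/-- The complementary error function. -/
def erfc (x : ℝ) : ℝ := (2 / Real.sqrt Real.pi) * ∫ s in Set.Ioi x, Real.exp (-s ^ 2)

/-- Kummer's confluent hypergeometric function `M(a,b,z)` (real arguments). -/
def kummerM (a b z : ℝ) : ℝ :=
  ∑' n : ℕ, (Polynomial.eval a (ascPochhammer ℝ n) / Polynomial.eval b (ascPochhammer ℝ n))
    * z ^ n / (n.factorial : ℝ)

/-- `κ = (1 + √(4γ+1))/2`, the positive root of `κ(κ-1) = γ`. -/
def kappaOf (γ : ℝ) : ℝ := (1 + Real.sqrt (4 * γ + 1)) / 2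

/-- The value `u*_γ` determined by the derivative matching condition. -/
def ustarGamma (α β γ : ℝ) : ℝ :=
  (α * β / 2) *
    (kappaOf γ * kummerM (kappaOf γ / 2 + 1) (kappaOf γ + 1 / 2) (-α ^ 2 / 4) /
        (α * kummerM (kappaOf γ / 2) (kappaOf γ + 1 / 2) (-α ^ 2 / 4)) +
      Real.exp (-α ^ 2 / 4) / (Real.sqrt Real.pi * erfc (α / 2)))⁻¹

/-- The self-similar profile `Φ_γ`. -/
def Phi (α β γ η : ℝ) : ℝ :=
  if η < α then
    ustarGamma α β γ * η ^ kappaOf γ *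
      kummerM (kappaOf γ / 2) (kappaOf γ + 1 / 2) (-η ^ 2 / 4) /
      (α ^ kappaOf γ * kummerM (kappaOf γ / 2) (kappaOf γ + 1 / 2) (-α ^ 2 / 4))
  else ustarGamma α β γ * erfc (η / 2) / erfc (α / 2)

theorem eq_neg_primitive_of_forall_test {T : ℝ} (hT : 0 < T) {m n : ℝ → ℝ} (hm : Continuous m)
    (hn : ∀ a b, IntervalIntegrable n volume a b)
    (h : ∀ ω : ℝ → ℝ, Continuous ω →
      ∫ t in (0:ℝ)..T, ω t * m t = ∫ t in (0:ℝ)..T, (∫ s in T..t, ω s) * n t) :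
    ∀ t ∈ Icc 0 T, m t = -∫ s in (0:ℝ)..t, n s := by
  set N : ℝ → ℝ := fun t => ∫ s in (0:ℝ)..t, n s with hN
  have hNc : Continuous N := intervalIntegral.continuous_primitive hn 0
  set ω : ℝ → ℝ := fun t => m t + N t with hω
  have hωc : Continuous ω := hm.add hNc
  set χ : ℝ → ℝ := fun t => ∫ s in T..t, ω s with hχ
  have hχac : AbsolutelyContinuousOnInterval χ 0 T :=
    (hωc.intervalIntegrable 0 T).absolutelyContinuousOnInterval_intervalIntegral (by simp)
  have hNac : AbsolutelyContinuousOnInterval N 0 T :=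
    (hn 0 T).absolutelyContinuousOnInterval_intervalIntegral (by simp)
  have hdχ : deriv χ = ω := by
    funext t
    exact hωc.deriv_integral _ T t
  have hdN : ∀ᵐ t, t ∈ uIoc 0 T → χ t * n t = χ t * deriv N t := by
    filter_upwards [(hn 0 T).ae_hasDerivAt_integral] with t ht ht'
    rw [(ht (uIoc_subset_uIcc ht') 0 (by simp)).deriv]
  have hparts := hχac.integral_mul_deriv_eq_deriv_mul hNac
  have h1 := h ω hωc
  rw [intervalIntegral.integral_congr_ae hdN, hparts, hdχ] at h1
  have hχT : χ T = 0 := by simp [hχ]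
  have hN0 : N 0 = 0 := by simp [hN]
  rw [hχT, hN0] at h1
  have h2 : ∫ t in (0:ℝ)..T, ω t * ω t = 0 := by
    have : ∀ t, ω t * ω t = ω t * m t + ω t * N t := fun t => by simp only [hω]; ring
    simp_rw [this]
    have i1 : IntervalIntegrable (fun t => ω t * m t) volume 0 T :=
      (hωc.mul hm).intervalIntegrable _ _
    have i2 : IntervalIntegrable (fun t => ω t * N t) volume 0 T :=
      (hωc.mul hNc).intervalIntegrable _ _
    rw [intervalIntegral.integral_add i1 i2, h1]
    ring
  rw [intervalIntegral.integral_of_le hT.le, ← integral_Icc_eq_integral_Ioc,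
    setIntegral_eq_zero_iff_of_nonneg_ae
      (Eventually.of_forall fun t => mul_self_nonneg (ω t))
      ((hωc.mul hωc).continuousOn.integrableOn_compact isCompact_Icc)] at h2
  have h3 := Measure.eqOn_Icc_of_ae_eq (μ := volume) hT.ne h2 (hωc.mul hωc).continuousOn
    continuousOn_const
  intro t ht
  have h4 : ω t = 0 := mul_self_eq_zero.mp (h3 ht)
  simp only [hω] at h4
  linarith

/-- One-sided second derivative test at a local maximum. -/
theorem second_deriv_nonpos_of_isLocalMax {F F1 : ℝ → ℝ} {y c : ℝ}
    (h1 : ∀ x, HasDerivAt F (F1 x) x) (h2 : HasDerivAt F1 c y) (hmax : IsLocalMax F y) :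
    c ≤ 0 := by
  by_contra! hc
  have hd : deriv F = F1 := funext fun x => (h1 x).deriv
  have hmin : IsLocalMin F y := by
    apply isLocalMin_of_deriv_deriv_pos
    · rw [hd, h2.deriv]; exact hc
    · exact hmax.deriv_eq_zero
    · exact (h1 y).continuousAt
  have heq : F =ᶠ[nhds y] fun _ => F y := by
    filter_upwards [hmax, hmin] with x h h' using le_antisymm h h'
  have h0 : F1 =ᶠ[nhds y] fun _ => 0 := by
    have := heq.deriv
    rw [hd] at this
    simpa using this
  have := h0.deriv_eq
  rw [h2.deriv] at this
  simp at this
  exact hc.ne' this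

/-- A maximum principle on the whole line for bounded functions that satisfy the heat inequality,
integrated in time, wherever they exceed the level `k`. -/
theorem le_of_integrated_heat_subsolution {V V1 V2 : ℝ → ℝ → ℝ} {T k M : ℝ}
    (hV : Continuous fun q : ℝ × ℝ => V q.1 q.2) (hM : ∀ x t, |V x t| ≤ M)
    (h0 : ∀ x, V x 0 ≤ k)
    (h1 : ∀ x t, HasDerivAt (fun y => V y t) (V1 x t) x)
    (h2 : ∀ x t, HasDerivAt (fun y => V1 y t) (V2 x t) x)
    (hV2 : ∀ x, Continuous (V2 x))
    (hsub : ∀ x s t, 0 ≤ s → s ≤ t → t ≤ T → (∀ r ∈ Icc s t, k < V x r) →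
      V x t - V x s ≤ ∫ r in s..t, V2 x r) :
    ∀ x, ∀ t ∈ Icc 0 T, V x t ≤ k := by
  intro x₁ t₁ ht₁
  by_contra! hlt
  have hD : 0 < 1 + x₁ ^ 2 + 3 * t₁ := by nlinarith [sq_nonneg x₁, ht₁.1]
  obtain ⟨η, hη, hηlt⟩ : ∃ η > 0, η * (1 + x₁ ^ 2 + 3 * t₁) < V x₁ t₁ - k := by
    refine ⟨(V x₁ t₁ - k) / (2 * (1 + x₁ ^ 2 + 3 * t₁)), by
      apply div_pos <;> linarith, ?_⟩
    rw [div_mul_eq_mul_div, div_lt_iff₀ (by linarith)]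
    nlinarith
  set F : ℝ × ℝ → ℝ := fun q => V q.1 q.2 - k - η * (1 + q.1 ^ 2 + 3 * q.2) with hF
  have hFc : Continuous F := by
    simp only [hF]
    fun_prop
  set R : ℝ := |x₁| + 1 + (|M| + |k|) / η with hR
  have hR0 : 0 ≤ (|M| + |k|) / η := by positivity
  have hRx : |x₁| ≤ R := by linarith
  have hR1 : 1 ≤ R := by linarith [abs_nonneg x₁]
  have hRM : |M| + |k| ≤ η * R := by
    have : (|M| + |k|) / η ≤ R := by linarith [abs_nonneg x₁]
    rw [div_le_iff₀ hη] at this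
    linarith
  have hout : ∀ x t, 0 ≤ t → R < |x| → F (x, t) < 0 := by
    intro x t ht hx
    have hx2 : R ≤ x ^ 2 := by
      rw [← sq_abs]; nlinarith
    have := (abs_le.1 (hM x t)).2
    have h5 := mul_le_mul_of_nonneg_left hx2 hη.le
    simp only [hF]
    nlinarith [le_abs_self M, neg_abs_le k, mul_nonneg hη.le ht]
  obtain ⟨⟨y, τ⟩, hmem, hmax⟩ := ((isCompact_Icc (a := -R) (b := R)).prod
    (isCompact_Icc (a := (0:ℝ)) (b := T))).exists_isMaxOn
    ⟨(x₁, t₁), abs_le.1 hRx, ht₁⟩ hFc.continuousOn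
  obtain ⟨hy, hτ⟩ := hmem
  simp only at hy hτ
  have hpos : 0 < F (y, τ) := by
    refine lt_of_lt_of_le ?_ (hmax (a := (x₁, t₁)) ⟨abs_le.1 hRx, ht₁⟩)
    simp only [hF]
    linarith
  have hτ0 : 0 < τ := by
    rcases hτ.1.lt_or_eq with h | h
    · exact h
    · exfalso
      rw [← h] at hpos
      simp only [hF] at hpos
      nlinarith [h0 y, sq_nonneg y]
  have hmaxx : ∀ x, F (x, τ) ≤ F (y, τ) := by
    intro x
    by_cases hx : |x| ≤ R
    · exact hmax (a := (x, τ)) ⟨abs_le.1 hx, hτ⟩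
    · exact ((hout x τ hτ.1 (not_le.1 hx)).trans hpos).le
  have hmaxt : ∀ s ∈ Icc 0 T, F (y, s) ≤ F (y, τ) := fun s hs =>
    hmax (a := (y, s)) ⟨hy, hs⟩
  have hsec : V2 y τ - 2 * η ≤ 0 := by
    refine second_deriv_nonpos_of_isLocalMax (F := fun x => F (x, τ))
      (F1 := fun x => V1 x τ - 2 * η * x) (y := y) ?_ ?_ (Eventually.of_forall hmaxx)
    · intro x
      have := ((h1 x τ).sub_const k).sub
        ((((hasDerivAt_pow 2 x).const_add 1).add_const (3 * τ)).const_mul η)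
      convert! this using 1
      simp; ring
    · have := (h2 y τ).sub ((hasDerivAt_id y).const_mul (2 * η))
      convert! this using 1
      simp
  have hVc : Continuous (V y) := hV.comp (by fun_prop : Continuous fun t : ℝ => (y, t))
  have hkV : k < V y τ := by
    simp only [hF] at hpos
    nlinarith [sq_nonneg y]
  have hev : ∀ᶠ r in nhds τ, k < V y r ∧ V2 y r < 5 / 2 * η :=
    (hVc.continuousAt.eventually_const_lt hkV).and
      ((hV2 y).continuousAt.eventually_lt_const (by linarith))
  obtain ⟨δ, hδ, hball⟩ := Metric.eventually_nhds_iff.1 hev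
  set s := max 0 (τ - δ / 2) with hs
  have hsτ : s < τ := max_lt hτ0 (by linarith)
  have hs0 : 0 ≤ s := le_max_left _ _
  have hnear : ∀ r ∈ Icc s τ, k < V y r ∧ V2 y r < 5 / 2 * η := by
    intro r hr
    apply hball
    rw [Real.dist_eq, abs_lt]
    have := le_max_right 0 (τ - δ / 2)
    constructor <;> linarith [hr.1, hr.2]
  have hle := hsub y s τ hs0 hsτ.le hτ.2 fun r hr => (hnear r hr).1
  have hint : ∫ r in s..τ, V2 y r ≤ ∫ r in s..τ, 5 / 2 * η :=
    intervalIntegral.integral_mono_on hsτ.le ((hV2 y).intervalIntegrable _ _)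
      (by simp) fun r hr => (hnear r hr).2.le
  rw [intervalIntegral.integral_const, smul_eq_mul] at hint
  have := hmaxt s ⟨hs0, hsτ.le.trans hτ.2⟩
  simp only [hF] at this
  nlinarith [mul_pos hη (sub_pos.2 hsτ)]

theorem continuous_integral_mul_of_bounded {g : ℝ → ℝ} {v : ℝ → ℝ → ℝ} {C : ℝ}
    (hg : Continuous g) (hgc : HasCompactSupport g)
    (hv : Continuous fun q : ℝ × ℝ => v q.1 q.2) (hC : ∀ x t, |v x t| ≤ C) :
    Continuous fun t => ∫ x, g x * v x t := by
  refine continuous_of_dominated (bound := fun x => |g x| * C) (fun t => ?_) (fun t => ?_) ?_ ?_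
  · exact (hg.mul (hv.comp (by fun_prop : Continuous fun x : ℝ => (x, t)))).aestronglyMeasurable
  · refine Eventually.of_forall fun x => ?_
    rw [Real.norm_eq_abs, abs_mul]
    exact mul_le_mul_of_nonneg_left (hC x t) (abs_nonneg _)
  · exact (hg.integrable_of_hasCompactSupport hgc).abs.mul_const C
  · exact Eventually.of_forall fun x =>
      continuous_const.mul (hv.comp (by fun_prop : Continuous fun t : ℝ => (x, t)))

theorem integrable_mul_of_bounded {g f : ℝ → ℝ} {C : ℝ}
    (hg : Continuous g) (hgc : HasCompactSupport g) (hf : Measurable f) (hC : ∀ x, |f x| ≤ C) :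
    Integrable fun x => f x * g x :=
  (hg.integrable_of_hasCompactSupport hgc).bdd_mul hf.aestronglyMeasurable
    (Eventually.of_forall hC)

theorem intervalIntegrable_integral_mul_of_bounded {g : ℝ → ℝ} {f : ℝ → ℝ → ℝ} {C : ℝ}
    (hg : Continuous g) (hgc : HasCompactSupport g)
    (hf : Measurable fun q : ℝ × ℝ => f q.1 q.2) (hC : ∀ x t, |f x t| ≤ C) (a b : ℝ) :
    IntervalIntegrable (fun t => ∫ x, f x t * g x) volume a b := by
  have hm : StronglyMeasurable fun t => ∫ x, f x t * g x := by
    have : Measurable fun q : ℝ × ℝ => f q.2 q.1 * g q.2 :=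
      (hf.comp measurable_swap).mul (hg.measurable.comp measurable_snd)
    exact this.stronglyMeasurable.integral_prod_right'
  refine (intervalIntegrable_const (c := ∫ x, C * |g x|)).mono_fun hm.aestronglyMeasurable
    (Eventually.of_forall fun t => ?_)
  refine (norm_integral_le_integral_norm _).trans (le_trans ?_ (le_abs_self _))
  refine integral_mono_of_nonneg (Eventually.of_forall fun x => norm_nonneg _)
    ((hg.integrable_of_hasCompactSupport hgc).abs.const_mul C) (Eventually.of_forall fun x => ?_)
  simp only [Real.norm_eq_abs, abs_mul]
  exact mul_le_mul_of_nonneg_right (hC x t) (abs_nonneg _)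

/-- The weak form of `v_t = v_xx - f` with zero initial data, `w` standing for `v_x`, tested with
a function of `x` alone and integrated in time. -/
theorem integral_mul_eq_of_weak_form {T C : ℝ} (hT : 0 < T) {v w f : ℝ → ℝ → ℝ}
    (hv : Continuous fun q : ℝ × ℝ => v q.1 q.2) (hw : Continuous fun q : ℝ × ℝ => w q.1 q.2)
    (hvC : ∀ x t, |v x t| ≤ C) (hwC : ∀ x t, |w x t| ≤ C)
    (hfm : Measurable fun q : ℝ × ℝ => f q.1 q.2) (hfC : ∀ x t, |f x t| ≤ C)
    (hweak : ∀ φ φt φx : ℝ → ℝ → ℝ, IsTestFun T φ φt φx →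
      (∫ t in Ioc (0:ℝ) T, ∫ x : ℝ, φt x t * v x t)
        = ∫ t in Ioc (0:ℝ) T, ∫ x : ℝ, (φx x t * w x t + f x t * φ x t))
    {g : ℝ → ℝ} (hg : ContDiff ℝ 1 g) (hgc : HasCompactSupport g) :
    ∀ t ∈ Icc 0 T, ∫ x, g x * v x t =
      -∫ s in (0:ℝ)..t, ((∫ x, deriv g x * w x s) + ∫ x, f x s * g x) := by
  have hg' : Continuous (deriv g) := hg.continuous_deriv_one
  have hgc' : HasCompactSupport (deriv g) := hgc.deriv
  refine eq_neg_primitive_of_forall_test hT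
    (continuous_integral_mul_of_bounded hg.continuous hgc hv hvC)
    (fun a b => ((continuous_integral_mul_of_bounded hg' hgc' hw hwC).intervalIntegrable a b).add
      (intervalIntegrable_integral_mul_of_bounded hg.continuous hgc hfm hfC a b)) fun ω hω => ?_
  have hχ : ∀ t, HasDerivAt (fun t => ∫ s in T..t, ω s) (ω t) t := fun t =>
    intervalIntegral.integral_hasDerivAt_right (hω.intervalIntegrable _ _)
      hω.aestronglyMeasurable.stronglyMeasurableAtFilter hω.continuousAt
  have hχc : Continuous fun t => ∫ s in T..t, ω s :=
    continuous_iff_continuousAt.2 fun t => (hχ t).continuousAt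
  have htest : IsTestFun T (fun x t => g x * ∫ s in T..t, ω s) (fun x t => g x * ω t)
      (fun x t => deriv g x * ∫ s in T..t, ω s) := by
    refine ⟨fun x t _ => ((hχ t).const_mul (g x)).hasDerivWithinAt, fun x t _ => ?_, ?_, ?_, ?_,
      ?_, ?_⟩
    · exact ((hg.differentiable one_ne_zero) x).hasDerivAt.mul_const _
    · exact ((hg.continuous.comp continuous_fst).mul (hχc.comp continuous_snd)).continuousOn
    · exact ((hg.continuous.comp continuous_fst).mul (hω.comp continuous_snd)).continuousOn
    · exact ((hg'.comp continuous_fst).mul (hχc.comp continuous_snd)).continuousOn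
    · obtain ⟨R, hR⟩ := hgc.isCompact.isBounded.subset_ball 0
      refine ⟨R, fun x t _ hx => ?_⟩
      have : g x = 0 := by
        by_contra hne
        have := hR (subset_tsupport _ hne)
        rw [Metric.mem_ball, dist_zero_right, Real.norm_eq_abs] at this
        linarith
      simp [this]
    · intro x
      simp
  have h := hweak _ _ _ htest
  rw [intervalIntegral.integral_of_le hT.le, intervalIntegral.integral_of_le hT.le]
  convert! h using 3
  · rename_i t
    rw [← integral_const_mul]
    exact integral_congr_ae (Eventually.of_forall fun x => by ring)
  · rename_i t
    have hwt : Measurable fun x => w x t :=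
      (hw.comp (by fun_prop : Continuous fun x : ℝ => (x, t))).measurable
    have hft : Measurable fun x => f x t := hfm.comp (by fun_prop : Measurable fun x : ℝ => (x, t))
    have i1 : Integrable fun x => deriv g x * w x t := by
      simpa only [mul_comm] using integrable_mul_of_bounded hg' hgc' hwt (fun x => hwC x t)
    rw [← integral_add i1 (integrable_mul_of_bounded hg.continuous hgc hft (fun x => hfC x t)),
      ← integral_const_mul]
    exact integral_congr_ae (Eventually.of_forall fun x => by ring)

theorem integral_mul_kernel_le {ρ v : ℝ → ℝ} {y ε c : ℝ} (hρ : Continuous ρ)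
    (hρc : HasCompactSupport ρ) (hρ0 : ∀ x, 0 ≤ ρ x) (hρ1 : ∫ x, ρ x = 1)
    (hsupp : ∀ x, ε ≤ |x| → ρ x = 0) (hv : Continuous v) (h : ∀ x, |y - x| < ε → v x ≤ c) :
    ∫ x, v x * ρ (y - x) ≤ c := by
  have hcs : HasCompactSupport fun x => ρ (y - x) := hρc.comp_homeomorph (Homeomorph.subLeft y)
  have hcont : Continuous fun x => ρ (y - x) := by fun_prop
  calc ∫ x, v x * ρ (y - x) ≤ ∫ x, c * ρ (y - x) := by
        refine integral_mono ((hv.mul hcont).integrable_of_hasCompactSupport hcs.mul_left)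
          ((hcont.integrable_of_hasCompactSupport hcs).const_mul c) fun x => ?_
        by_cases hx : |y - x| < ε
        · exact mul_le_mul_of_nonneg_right (h x hx) (hρ0 _)
        · simp [hsupp _ (not_lt.1 hx)]
    _ = c := by
        rw [integral_const_mul, integral_sub_left_eq_self ρ volume y, hρ1, mul_one]

/-- A bounded weak subsolution of the heat equation with zero initial data is nonpositive, if
the sink `f` is nonnegative wherever the solution is positive. -/
theorem nonpos_of_weak_form {T C : ℝ} (hT : 0 < T) {v w f : ℝ → ℝ → ℝ}
    (hv : Continuous fun q : ℝ × ℝ => v q.1 q.2) (hw : Continuous fun q : ℝ × ℝ => w q.1 q.2)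
    (hd : ∀ x t, HasDerivAt (fun y => v y t) (w x t) x)
    (hvC : ∀ x t, |v x t| ≤ C) (hwC : ∀ x t, |w x t| ≤ C)
    (hfm : Measurable fun q : ℝ × ℝ => f q.1 q.2) (hfC : ∀ x t, |f x t| ≤ C)
    (hf : ∀ x t, 0 < v x t → 0 ≤ f x t)
    (hweak : ∀ φ φt φx : ℝ → ℝ → ℝ, IsTestFun T φ φt φx →
      (∫ t in Ioc (0:ℝ) T, ∫ x : ℝ, φt x t * v x t)
        = ∫ t in Ioc (0:ℝ) T, ∫ x : ℝ, (φx x t * w x t + f x t * φ x t)) :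
    ∀ x, ∀ t ∈ Icc 0 T, v x t ≤ 0 := by
  have hC : 0 ≤ C := (abs_nonneg _).trans (hvC 0 0)
  have hvt : ∀ t, Continuous fun x => v x t := fun t =>
    hv.comp (by fun_prop : Continuous fun x : ℝ => (x, t))
  have hwt : ∀ t, Continuous fun x => w x t := fun t =>
    hw.comp (by fun_prop : Continuous fun x : ℝ => (x, t))
  have hlip : ∀ x y t, v x t - v y t ≤ C * |x - y| := by
    intro x y t
    have := (convex_univ (𝕜 := ℝ) (E := ℝ)).norm_image_sub_le_of_norm_hasDerivWithin_le
      (f := fun x => v x t) (f' := fun x => w x t) (C := C) (x := y) (y := x)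
      (fun x _ => (hd x t).hasDerivWithinAt) (fun x _ => hwC x t) trivial trivial
    exact (le_abs_self _).trans this
  suffices key : ∀ ε > 0, ∀ x, ∀ t ∈ Icc 0 T, v x t ≤ 3 * (C * ε) by
    intro x t ht
    by_contra! hpos
    have := key (v x t / (4 * (C + 1))) (by positivity) x t ht
    have h2 : C * (v x t / (4 * (C + 1))) ≤ v x t / 4 := by
      rw [mul_div_assoc', div_le_iff₀ (by positivity)]
      nlinarith
    linarith
  intro ε hε
  obtain ⟨ρ, hρs, hρc, hρ0, hρ1, hsupp⟩ : ∃ ρ : ℝ → ℝ, ContDiff ℝ 3 ρ ∧ HasCompactSupport ρ ∧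
      (∀ x, 0 ≤ ρ x) ∧ ∫ x, ρ x = 1 ∧ ∀ x, ε ≤ |x| → ρ x = 0 := by
    let b : ContDiffBump (0 : ℝ) := ⟨ε / 2, ε, by positivity, by linarith⟩
    refine ⟨b.normed volume, b.contDiff_normed (n := 3), b.hasCompactSupport_normed,
      b.nonneg_normed, b.integral_normed, fun x hx => ?_⟩
    rw [← Function.notMem_support, b.support_normed_eq]
    simpa [b] using hx
  have hρ1s : ContDiff ℝ 2 (deriv ρ) := (hρs.of_le (by norm_num) : ContDiff ℝ (2 + 1) ρ).deriv'
  have hρ2s : ContDiff ℝ 1 (deriv (deriv ρ)) := 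
    (hρ1s.of_le (by norm_num) : ContDiff ℝ (1 + 1) (deriv ρ)).deriv'
  have hρ1c : HasCompactSupport (deriv ρ) := hρc.deriv
  have hρ2c : HasCompactSupport (deriv (deriv ρ)) := hρ1c.deriv
  set V : ℝ → ℝ → ℝ := fun y t => ∫ x, v x t * ρ (y - x) with hV
  set V2 : ℝ → ℝ → ℝ := fun y t => ∫ x, v x t * deriv (deriv ρ) (y - x) with hV2
  have hcs : ∀ {σ : ℝ → ℝ}, HasCompactSupport σ → ∀ y, HasCompactSupport fun x => σ (y - x) :=
    fun h y => h.comp_homeomorph (Homeomorph.subLeft y)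
  have hconv : ∀ σ : ℝ → ℝ, HasCompactSupport σ → ContDiff ℝ 1 σ → ∀ y t,
      HasDerivAt (fun y => ∫ x, v x t * σ (y - x)) (∫ x, v x t * deriv σ (y - x)) y :=
    fun σ h1 h2 y t => h1.hasDerivAt_convolution_right (ContinuousLinearMap.mul ℝ ℝ)
      (hvt t).locallyIntegrable h2 y
  have hVC : ∀ y t, |V y t| ≤ C := by
    intro y t
    rw [abs_le]
    constructor
    · have := integral_mul_kernel_le (y := y) hρs.continuous hρc hρ0 hρ1 hsupp (hvt t).fun_neg
        (c := C) fun x _ => (neg_le_abs _).trans (hvC x t)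
      simp only [neg_mul, integral_neg] at this
      linarith
    · exact integral_mul_kernel_le (y := y) hρs.continuous hρc hρ0 hρ1 hsupp (hvt t)
        fun x _ => (le_abs_self _).trans (hvC x t)
  have hVv : ∀ y t, v y t ≤ V y t + C * ε := by
    intro y t
    have := integral_mul_kernel_le (y := y) hρs.continuous hρc hρ0 hρ1 hsupp (hvt t).fun_neg
      (c := C * ε - v y t) fun x hx => by
        have h1 := hlip y x t
        have h2 := mul_le_mul_of_nonneg_left hx.le hC
        linarith
    simp only [neg_mul, integral_neg] at this
    linarith
  have hVpos : ∀ y t, 2 * (C * ε) < V y t → ∀ x, |y - x| < ε → 0 < v x t := by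
    intro y t hlt x hx
    by_contra! hneg
    refine hlt.not_ge (integral_mul_kernel_le (y := y) hρs.continuous hρc hρ0 hρ1 hsupp (hvt t)
      fun z hz => ?_)
    have h1 := hlip z x t
    have h2 : |z - x| ≤ 2 * ε := by
      have := abs_sub_le z y x
      rw [abs_sub_comm z y] at this
      linarith
    have h3 := mul_le_mul_of_nonneg_left h2 hC
    linarith
  have hVcont : Continuous fun q : ℝ × ℝ => V q.1 q.2 := by
    have : (fun q : ℝ × ℝ => V q.1 q.2) = fun q : ℝ × ℝ => ∫ z, v (q.1 - z) q.2 * ρ z := by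
      funext q
      rw [← integral_sub_left_eq_self (fun z => v (q.1 - z) q.2 * ρ z) volume q.1]
      simp [hV]
    rw [this]
    refine continuous_of_dominated (bound := fun z => C * |ρ z|) (fun q => ?_) (fun q => ?_) ?_ ?_
    · exact (((hvt q.2).comp (by fun_prop : Continuous fun z => q.1 - z)).mul
        hρs.continuous).aestronglyMeasurable
    · refine Eventually.of_forall fun z => ?_
      rw [Real.norm_eq_abs, abs_mul]
      exact mul_le_mul_of_nonneg_right (hvC _ _) (abs_nonneg _)
    · exact (hρs.continuous.integrable_of_hasCompactSupport hρc).abs.const_mul C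
    · refine Eventually.of_forall fun z => Continuous.mul ?_ continuous_const
      exact hv.comp (by fun_prop : Continuous fun q : ℝ × ℝ => (q.1 - z, q.2))
  have hV2cont : ∀ y, Continuous (V2 y) := by
    intro y
    have := continuous_integral_mul_of_bounded
      (hρ2s.continuous.comp (by fun_prop : Continuous fun x => y - x)) (hcs hρ2c y) hv hvC
    simpa only [hV2, mul_comm, Function.comp_def] using this
  have hparts : ∀ y t, ∫ x, deriv (fun x => ρ (y - x)) x * w x t = -V2 y t := by
    intro y t
    have e1 : ∀ x, deriv (fun x => ρ (y - x)) x = -deriv ρ (y - x) := fun x =>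
      deriv_comp_const_sub ρ y x
    have hdρ : ∀ x, HasDerivAt (fun x => deriv ρ (y - x)) (-deriv (deriv ρ) (y - x)) x := by
      intro x
      have h1 := ((hρ1s.differentiable two_ne_zero) (y - x)).hasDerivAt
      simpa using h1.comp_const_sub y x
    have hc1 : Continuous fun x => deriv ρ (y - x) :=
      hρ1s.continuous.comp (by fun_prop)
    have hc2 : Continuous fun x => deriv (deriv ρ) (y - x) :=
      hρ2s.continuous.comp (by fun_prop)
    have := integral_mul_deriv_eq_deriv_mul_of_integrable (u := fun x => deriv ρ (y - x))
      (v := fun x => v x t) (fun x _ => hdρ x) (fun x _ => hd x t)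
      ((hc1.mul (hwt t)).integrable_of_hasCompactSupport (hcs hρ1c y).mul_right)
      ((hc2.neg.mul (hvt t)).integrable_of_hasCompactSupport (hcs hρ2c y).neg.mul_right)
      ((hc1.mul (hvt t)).integrable_of_hasCompactSupport (hcs hρ1c y).mul_right)
    simp only [e1, neg_mul, integral_neg, neg_neg] at this ⊢
    rw [this]
    simp only [hV2, mul_comm]
  have hVint : ∀ y, ∀ t ∈ Icc 0 T, V y t =
      -∫ s in (0:ℝ)..t, (-V2 y s + ∫ x, f x s * ρ (y - x)) := by
    intro y t ht
    have hρy : ContDiff ℝ 1 fun x => ρ (y - x) :=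
      (hρs.of_le (by norm_num)).comp (contDiff_const.sub contDiff_id)
    have := integral_mul_eq_of_weak_form hT hv hw hvC hwC hfm hfC hweak hρy (hcs hρc y) t ht
    simp only [hparts] at this
    rw [← this]
    simp only [hV, mul_comm]
  have hFint : ∀ y a b, IntervalIntegrable (fun s => ∫ x, f x s * ρ (y - x)) volume a b :=
    fun y a b => intervalIntegrable_integral_mul_of_bounded
      (hρs.continuous.comp (by fun_prop : Continuous fun x => y - x)) (hcs hρc y) hfm hfC a b
  have hVle := le_of_integrated_heat_subsolution (T := T) (k := 2 * (C * ε)) hVcont hVC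
    (fun x => by
      by_cases hT' : (0:ℝ) ∈ Icc 0 T
      · rw [hVint x 0 hT', intervalIntegral.integral_same]
        simp only [neg_zero]
        positivity
      · exact absurd ⟨le_rfl, hT.le⟩ hT')
    (hconv ρ hρc (hρs.of_le (by norm_num))) (hconv _ hρ1c (hρ1s.of_le (by norm_num))) hV2cont
    (fun y s t hs hst ht hk => by
      have hi : ∀ a b, IntervalIntegrable (fun s => -V2 y s + ∫ x, f x s * ρ (y - x)) volume a b :=
        fun a b => ((hV2cont y).neg.intervalIntegrable a b).add (hFint y a b)
      rw [hVint y t ⟨hs.trans hst, ht⟩, hVint y s ⟨hs, hst.trans ht⟩,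
        ← intervalIntegral.integral_add_adjacent_intervals (hi 0 s) (hi s t),
        intervalIntegral.integral_add ((hV2cont y).fun_neg.intervalIntegrable s t)
          (hFint y s t), intervalIntegral.integral_neg]
      have : 0 ≤ ∫ r in s..t, ∫ x, f x r * ρ (y - x) := by
        refine intervalIntegral.integral_nonneg hst fun r hr => integral_nonneg fun x => ?_
        by_cases hx : |y - x| < ε
        · exact mul_nonneg (hf x r (hVpos y r (hk r hr) x hx)) (hρ0 _)
        · simp [hsupp _ (not_lt.1 hx)]
      linarith)
  intro x t ht
  linarith [hVle x t ht, hVv x t]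

/-- Version of `nonpos_of_weak_form` for functions that are only controlled for `0 ≤ t ≤ T`. -/
theorem nonpos_of_weak_form_on {T C : ℝ} (hT : 0 < T) {v w f : ℝ → ℝ → ℝ}
    (hv : ContinuousOn (fun q : ℝ × ℝ => v q.1 q.2) (univ ×ˢ Ici 0))
    (hw : ContinuousOn (fun q : ℝ × ℝ => w q.1 q.2) (univ ×ˢ Ici 0))
    (hd : ∀ t ∈ Ici (0:ℝ), ∀ x, HasDerivAt (fun y => v y t) (w x t) x)
    (hvC : ∀ x, ∀ t ∈ Icc 0 T, |v x t| ≤ C) (hwC : ∀ x, ∀ t ∈ Icc 0 T, |w x t| ≤ C)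
    (hfm : Measurable fun q : ℝ × ℝ => f q.1 (max 0 (min T q.2)))
    (hfC : ∀ x, ∀ t ∈ Icc 0 T, |f x t| ≤ C)
    (hf : ∀ x, ∀ t ∈ Icc 0 T, 0 < v x t → 0 ≤ f x t)
    (hweak : ∀ φ φt φx : ℝ → ℝ → ℝ, IsTestFun T φ φt φx →
      (∫ t in Ioc (0:ℝ) T, ∫ x : ℝ, φt x t * v x t)
        = ∫ t in Ioc (0:ℝ) T, ∫ x : ℝ, (φx x t * w x t + f x t * φ x t)) :
    ∀ x, ∀ t ∈ Icc 0 T, v x t ≤ 0 := by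
  have hcl : ∀ t, max 0 (min T t) ∈ Icc 0 T := fun t =>
    ⟨le_max_left _ _, max_le hT.le (min_le_left _ _)⟩
  have hid : ∀ t ∈ Icc 0 T, max 0 (min T t) = t := fun t ht => by
    rw [min_eq_right ht.2, max_eq_right ht.1]
  have hcont : ∀ {h : ℝ → ℝ → ℝ}, ContinuousOn (fun q : ℝ × ℝ => h q.1 q.2) (univ ×ˢ Ici 0) →
      Continuous fun q : ℝ × ℝ => h q.1 (max 0 (min T q.2)) := fun h =>
    h.comp_continuous (f := fun q : ℝ × ℝ => (q.1, max 0 (min T q.2))) (by fun_prop)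
      fun q => ⟨trivial, (hcl q.2).1⟩
  intro x t ht
  have := nonpos_of_weak_form hT (v := fun x t => v x (max 0 (min T t)))
    (w := fun x t => w x (max 0 (min T t))) (f := fun x t => f x (max 0 (min T t)))
    (hcont hv) (hcont hw) (fun x t => hd _ (hcl t).1 x) (fun x t => hvC x _ (hcl t))
    (fun x t => hwC x _ (hcl t)) hfm (fun x t => hfC x _ (hcl t))
    (fun x t => hf x _ (hcl t)) (fun φ φt φx hφ => by
      refine Eq.trans (setIntegral_congr_fun measurableSet_Ioc fun s hs => ?_)
        ((hweak φ φt φx hφ).trans (setIntegral_congr_fun measurableSet_Ioc fun s hs => ?_))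
      all_goals simp only [hid s (Ioc_subset_Icc_self hs)]) x t ht
  simpa only [hid t ht] using this

theorem integrable_exp_neg_sq_div_four : Integrable fun ζ : ℝ => Real.exp (-ζ ^ 2 / 4) := by
  convert! integrable_exp_neg_mul_sq (b := 1 / 4) (by norm_num) using 3 with ζ
  ring

theorem PsiP_nonneg {α β : ℝ} (hα : 0 < α) (hβ : 0 < β) (η : ℝ) : 0 ≤ PsiP α β η :=
  mul_nonneg (by positivity) (integral_nonneg fun _ => (Real.exp_pos _).le)

theorem psi_nonneg {α β : ℝ} (hα : 0 < α) (hβ : 0 < β) (x t : ℝ) : 0 ≤ psi α β x t := by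
  unfold psi
  split_ifs
  · exact PsiP_nonneg hα hβ _
  · exact le_rfl

theorem antitone_setIntegral_Ioi_exp :
    Antitone fun a : ℝ => ∫ ζ in Ioi a, Real.exp (-ζ ^ 2 / 4) := fun _ _ hab =>
  setIntegral_mono_set integrable_exp_neg_sq_div_four.integrableOn
    (Eventually.of_forall fun _ => (Real.exp_pos _).le) (Ioi_subset_Ioi hab).eventuallyLE

theorem psi_le_PsiP {α β : ℝ} (hα : 0 < α) (hβ : 0 < β) (x t : ℝ) :
    psi α β x t ≤ PsiP α β α := by
  by_cases ht : 0 < t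
  · rw [psi, if_pos ht, PsiP]
    refine mul_le_mul_of_nonneg_left (antitone_setIntegral_Ioi_exp ?_) (by positivity)
    rw [max_self]
    exact le_max_right _ _
  · rw [psi, if_neg ht]
    exact PsiP_nonneg hα hβ _

theorem psi_neg (α β x t : ℝ) : psi α β (-x) t = psi α β x t := by
  simp only [psi, abs_neg]

theorem measurable_psi (α β : ℝ) : Measurable fun q : ℝ × ℝ => psi α β q.1 q.2 := by
  unfold psi
  refine Measurable.ite (measurableSet_lt measurable_const measurable_snd)
    (Measurable.const_mul ?_ _) measurable_const
  exact antitone_setIntegral_Ioi_exp.measurable.comp (by fun_prop :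
    Measurable fun q : ℝ × ℝ => max (|q.1| / Real.sqrt q.2) α)

theorem psi_isWeakSolution {α β ustar : ℝ} (hα : 0 < α) (hβ : 0 < β)
    (hsub : PsiP α β α < ustar) :
    IsWeakSolution α β ustar (fun x t => psi α β x t) (fun _ _ => 0) := by
  refine ⟨psi_neg α β, fun _ _ => rfl, measurable_const, fun x t ht => ⟨fun _ => rfl,
    fun _ => by simp, fun h => ?_⟩, fun x => monotoneOn_const, fun _ _ => 0,
    ⟨fun t _ x => ?_, ?_, continuousOn_const, fun T _ => ⟨0, fun x t _ => ?_⟩⟩,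
    fun T _ φ φt φx _ => ?_⟩
  · refine absurd (h.trans_le (csSup_le ((nonempty_Icc.2 ht).image _) ?_)) hsub.not_gt
    rintro _ ⟨s, _, rfl⟩
    exact psi_le_PsiP hα hβ x s
  · simpa using hasDerivAt_const x (0:ℝ)
  · simpa using continuousOn_const
  · simp
  · simp

/-- Below the threshold, a function dominated by `ψ` triggers no precipitation. -/
theorem sSup_image_lt_of_le_psi {α β ustar : ℝ} (hα : 0 < α) (hβ : 0 < β)
    (hsub : PsiP α β α < ustar) {u : ℝ → ℝ → ℝ} {x t : ℝ} (ht : 0 ≤ t)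
    (hle : ∀ s ∈ Icc 0 t, u x s ≤ psi α β x s) :
    sSup ((fun s => u x s) '' Icc 0 t) < ustar := by
  refine (csSup_le ((nonempty_Icc.2 ht).image _) ?_).trans_lt hsub
  rintro _ ⟨s, hs, rfl⟩
  exact (hle s hs).trans (psi_le_PsiP hα hβ x s)

theorem IsWeakSolution.precipitation_mem_Icc {α β ustar : ℝ} {u p : ℝ → ℝ → ℝ}
    (h : IsWeakSolution α β ustar u p) (x : ℝ) {t : ℝ} (ht : 0 ≤ t) : p x t ∈ Icc (0:ℝ) 1 := by
  obtain ⟨-, -, -, hp, -⟩ := h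
  obtain ⟨h1, h2, h3⟩ := hp x t ht
  rcases lt_trichotomy (sSup ((fun s => u x s) '' Icc 0 t)) ustar with h | h | h
  · simp [h1 h]
  · exact h2 h
  · simp [h3 h]

theorem IsWeakSolution.le_psi {α β ustar : ℝ} (hα : 0 < α) (hβ : 0 < β) {u p : ℝ → ℝ → ℝ}
    (h : IsWeakSolution α β ustar u p) (x : ℝ) {t : ℝ} (ht : 0 ≤ t) : u x t ≤ psi α β x t := by
  have hp := fun x t => h.precipitation_mem_Icc x (t := t)
  obtain ⟨-, -, hpm, -, -, w, ⟨hd, hv, hw, hb⟩, hweak⟩ := h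
  have hT : 0 < t + 1 := by linarith
  obtain ⟨C, hC⟩ := hb (t + 1) hT
  have hP := PsiP_nonneg hα hβ α
  have hclamp : Measurable fun q : ℝ × ℝ => (q.1, max 0 (min (t + 1) q.2)) := by fun_prop
  have hum : Measurable fun q : ℝ × ℝ => u q.1 (max 0 (min (t + 1) q.2)) := by
    have h1 : Continuous fun q : ℝ × ℝ =>
        u q.1 (max 0 (min (t + 1) q.2)) - psi α β q.1 (max 0 (min (t + 1) q.2)) :=
      hv.comp_continuous (f := fun q : ℝ × ℝ => (q.1, max 0 (min (t + 1) q.2))) (by fun_prop)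
        fun q => ⟨trivial, mem_Ici.2 (le_max_left _ _)⟩
    simpa [Function.comp_def] using h1.measurable.fun_add ((measurable_psi α β).comp hclamp)
  have key := nonpos_of_weak_form_on hT (C := C + PsiP α β α) (f := fun x t => p x t * u x t)
    hv hw hd (fun x s hs => (hC x s hs).1.trans (by linarith))
    (fun x s hs => (hC x s hs).2.trans (by linarith)) ((hpm.comp hclamp).mul hum)
    (fun x s hs => by
      have h1 := hp x s hs.1
      have h2 := abs_le.1 (hC x s hs).1
      have h3 := psi_nonneg hα hβ x s
      have h4 := psi_le_PsiP hα hβ x s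
      rw [abs_mul, abs_of_nonneg h1.1]
      refine (mul_le_of_le_one_left (abs_nonneg _) h1.2).trans (abs_le.2 ⟨?_, ?_⟩) <;> linarith)
    (fun x s hs hpos => mul_nonneg (hp x s hs.1).1 (by linarith [psi_nonneg hα hβ x s]))
    (hweak _ hT) x t ⟨ht, by linarith⟩
  linarith

theorem IsWeakSolution.psi_le_of_precipitation_eq_zero {α β ustar : ℝ} {u p : ℝ → ℝ → ℝ}
    (h : IsWeakSolution α β ustar u p) (hp : ∀ x t : ℝ, 0 ≤ t → p x t = 0) (x : ℝ) {t : ℝ}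
    (ht : 0 ≤ t) : psi α β x t ≤ u x t := by
  obtain ⟨-, -, -, -, -, w, ⟨hd, hv, hw, hb⟩, hweak⟩ := h
  have hT : 0 < t + 1 := by linarith
  obtain ⟨C, hC⟩ := hb (t + 1) hT
  have hC0 : 0 ≤ C := (abs_nonneg _).trans (hC 0 0 ⟨le_rfl, hT.le⟩).1
  have key := nonpos_of_weak_form_on hT (C := C) (v := fun x t => -(u x t - psi α β x t))
    (w := fun x t => -w x t) (f := fun _ _ => 0) hv.fun_neg hw.fun_neg
    (fun s hs x => (hd s hs x).fun_neg) (fun x s hs => by simpa only [abs_neg] using (hC x s hs).1)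
    (fun x s hs => by simpa only [abs_neg] using (hC x s hs).2) measurable_const
    (fun x s hs => by simpa using hC0) (fun _ _ _ _ => le_rfl) (fun φ φt φx hφ => by
      simp only [mul_neg, zero_mul, add_zero, integral_neg]
      rw [hweak _ hT φ φt φx hφ]
      refine congrArg _ (setIntegral_congr_fun measurableSet_Ioc fun s hs => ?_)
      simp only [hp _ s hs.1.le, zero_mul, add_zero]) x t ⟨ht, by linarith⟩
  linarith

/-- subcritical precipitation threshold: if `u* > Ψ(α)`, then `(ψ, 0)`
is the unique weak solution of the HHMO model. -/
theorem weak_sol_subcritical_unique (α β ustar : ℝ) (hα : 0 < α) (hβ : 0 < β)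
    (hu : 0 < ustar) (hsub : PsiP α β α < ustar) :
    IsWeakSolution α β ustar (fun x t => psi α β x t) (fun _ _ => 0) ∧
    ∀ u p : ℝ → ℝ → ℝ, IsWeakSolution α β ustar u p →
      (∀ x t : ℝ, 0 ≤ t → u x t = psi α β x t) ∧
      (∀ x t : ℝ, 0 ≤ t → p x t = 0) := by
  refine ⟨psi_isWeakSolution hα hβ hsub, fun u p h => ?_⟩
  have hp : ∀ x t : ℝ, 0 ≤ t → p x t = 0 := fun x t ht =>
    (h.2.2.2.1 x t ht).1 (sSup_image_lt_of_le_psi hα hβ hsub ht fun s hs => h.le_psi hα hβ x hs.1)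
  exact ⟨fun x t ht =>
    (h.le_psi hα hβ x ht).antisymm (h.psi_le_of_precipitation_eq_zero hp x ht), hp⟩

end
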